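/- High-probability mixing bound (Corollary 4.2): assume there exist constants β > 0 and κ > 0 (independent of n) such that 𝐏_n( π_t^min ≥ n^{−β} for every t ∈ {0,…,n} ) → 1 and 𝐏_n( Θ_t ≥ κ for every t ∈ {0,…,n} ) → 1 as n → ∞. Then for every ε ∈ (0,1): 𝐏_n( t_mix(ε,0) ≤ 1 + (2/κ)·[ log(n^β/2) + log(ε^{−1}) ] ) → 1 as n → ∞. -/

import Mathlib

open Filter MeasureTheory

/-- Measurable structure on `n × n` real matrices (entrywise). -/
instance (n : ℕ) : MeasurableSpace (Matrix (Fin n) (Fin n) ℝ) :=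
  MeasurableSpace.pi

/-- The product `P^{s,t} = P_{s+1} ⋯ P_t` (identity when `s ≥ t`). -/
noncomputable def mprod (n : ℕ) (P : ℤ → Matrix (Fin n) (Fin n) ℝ) (s t : ℤ) :
    Matrix (Fin n) (Fin n) ℝ :=
  ((List.range (t - s).toNat).map (fun i => P (s + 1 + i))).prod

/-- `π` is the family of target distributions for the sequence `P`. -/
def IsTarget (n : ℕ) (P : ℤ → Matrix (Fin n) (Fin n) ℝ) (π : ℤ → Fin n → ℝ) : Prop :=
  ∀ t : ℤ, (∀ y, 0 ≤ π t y) ∧ (∑ y, π t y = 1) ∧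
    ∀ x y, Tendsto (fun s : ℤ => mprod n P s t x y) atBot (nhds (π t y))

/-- `d(s,t) = max_x (1/2) ∑_z |P^{s,t}(x,z) − π_t(z)|`. -/
noncomputable def dTV (n : ℕ) (P : ℤ → Matrix (Fin n) (Fin n) ℝ)
    (π : ℤ → Fin n → ℝ) (s t : ℤ) : ℝ :=
  ⨆ x : Fin n, (1 / 2) * ∑ z, |mprod n P s t x z - π t z|

/-- The stationary flow `Q_s(A,B) = ∑_{x∈A} ∑_{y∈B} π_{s-1}(x) P_s(x,y)`. -/
noncomputable def flowQ (n : ℕ) (P : ℤ → Matrix (Fin n) (Fin n) ℝ)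
    (π : ℤ → Fin n → ℝ) (s : ℤ) (A B : Finset (Fin n)) : ℝ :=
  ∑ x ∈ A, ∑ y ∈ B, π (s - 1) x * P s x y

/-- `Φ_s(S) = (Q_s(S,Sᶜ) + Q_s(Sᶜ,S)) / (2 π_{s-1}(S))`. -/
noncomputable def bigPhi (n : ℕ) (P : ℤ → Matrix (Fin n) (Fin n) ℝ)
    (π : ℤ → Fin n → ℝ) (s : ℤ) (S : Finset (Fin n)) : ℝ :=
  (flowQ n P π s S Sᶜ + flowQ n P π s Sᶜ S) / (2 * ∑ x ∈ S, π (s - 1) x)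

/-- `Φ_s^* = inf{Φ_s(S) : S nonempty, π_{s-1}(S) ≤ 1/2}`. -/
noncomputable def bigPhiStar (n : ℕ) (P : ℤ → Matrix (Fin n) (Fin n) ℝ)
    (π : ℤ → Fin n → ℝ) (s : ℤ) : ℝ :=
  sInf {r | ∃ S : Finset (Fin n), S.Nonempty ∧ (∑ x ∈ S, π (s - 1) x) ≤ 1 / 2 ∧
    r = bigPhi n P π s S}

/-- `g_s = min_z π_{s-1}(z)/π_s(z)`. -/
noncomputable def gq (n : ℕ) (π : ℤ → Fin n → ℝ) (s : ℤ) : ℝ :=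
  ⨅ z : Fin n, π (s - 1) z / π s z

/-- `Θ_t = min_{1 ≤ s ≤ t} ((1/2)(g_s/(1−g_s/2))Φ_s^*)²`. -/
noncomputable def theta (n : ℕ) (P : ℤ → Matrix (Fin n) (Fin n) ℝ)
    (π : ℤ → Fin n → ℝ) (t : ℕ) : ℝ :=
  sInf {r | ∃ s : ℕ, 1 ≤ s ∧ s ≤ t ∧
    r = ((1 / 2) * (gq n π s / (1 - gq n π s / 2)) * bigPhiStar n P π s) ^ 2}

section Cheeger

variable {ι : Type*} [Fintype ι]

theorem exists_weighted_median [Nonempty ι] (p f : ι → ℝ) (hp1 : ∑ x, p x = 1) :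
    ∃ m : ℝ, ∑ x with m < f x, p x ≤ 1 / 2 ∧ ∑ x with f x < m, p x ≤ 1 / 2 := by
  classical
  let T : Finset ι := Finset.univ.filter fun x => ∑ y with f x < f y, p y ≤ 1 / 2
  have hT : T.Nonempty := by
    obtain ⟨x, -, hx⟩ := Finset.exists_max_image Finset.univ f Finset.univ_nonempty
    refine ⟨x, Finset.mem_filter.2 ⟨Finset.mem_univ _, ?_⟩⟩
    rw [Finset.filter_false_of_mem fun y hy => not_lt.2 (hx y hy)]
    norm_num
  obtain ⟨x₀, hx₀, hmin⟩ := Finset.exists_min_image T f hT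
  refine ⟨f x₀, (Finset.mem_filter.1 hx₀).2, ?_⟩
  rcases (Finset.univ.filter fun x => f x < f x₀).eq_empty_or_nonempty with he | hne
  · rw [he]; norm_num
  obtain ⟨x, hx, hmax⟩ := Finset.exists_max_image _ f hne
  have hxT : x ∉ T := fun h => (hmin x h).not_gt (Finset.mem_filter.1 hx).2
  have hgt : 1 / 2 < ∑ y with f x < f y, p y := by
    by_contra h
    exact hxT (Finset.mem_filter.2 ⟨Finset.mem_univ _, not_lt.1 h⟩)
  have hset : (Finset.univ.filter fun y => f y < f x₀)
      = Finset.univ.filter fun y => ¬ f x < f y := by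
    ext y
    simp only [Finset.mem_filter, Finset.mem_univ, true_and, not_lt]
    exact ⟨fun h => hmax y (by simpa using h), fun h => h.trans_lt (Finset.mem_filter.1 hx).2⟩
  have := Finset.sum_filter_add_sum_filter_not Finset.univ (fun y => f x < f y) p
  rw [hset]
  linarith

/-- Co-area inequality: a bound on the weight of cuts extends to functions supported on a set of
mass at most `1/2`. -/
theorem coarea_of_cut_bound (p : ι → ℝ) (hp : ∀ x, 0 ≤ p x) (w : ι → ι → ℝ) (φ : ℝ)
    (hcut : ∀ S : Finset ι, S.Nonempty → ∑ x ∈ S, p x ≤ 1 / 2 →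
      2 * φ * ∑ x ∈ S, p x ≤
        ∑ x, ∑ y, w x y * |(S : Set ι).indicator 1 x - (S : Set ι).indicator 1 y|)
    (u : ι → ℝ) (hu : ∀ x, 0 ≤ u x) (hsupp : ∑ x with 0 < u x, p x ≤ 1 / 2) :
    2 * φ * ∑ x, p x * u x ≤ ∑ x, ∑ y, w x y * |u x - u y| := by
  classical
  induction hk : (Finset.univ.filter fun x => 0 < u x).card using Nat.strong_induction_on
    generalizing u with
  | _ k ih =>
  subst hk
  set S := Finset.univ.filter fun x => 0 < u x with hS
  have hmem : ∀ x, x ∈ S ↔ 0 < u x := fun x => by simp [hS]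
  rcases S.eq_empty_or_nonempty with he | hne
  · have h0 : ∀ x, u x = 0 := fun x => by
      have : x ∉ S := by simp [he]
      rw [hmem] at this
      exact le_antisymm (not_lt.1 this) (hu x)
    simp [h0]
  obtain ⟨x₀, hx₀, hmin⟩ := Finset.exists_min_image S u hne
  set m := u x₀ with hm
  have hmpos : 0 < m := (hmem _).1 hx₀
  let i : ι → ℝ := (S : Set ι).indicator 1
  have hi1 : ∀ x, x ∈ S → i x = 1 := fun x hx => by simp [i, hx]
  have hi0 : ∀ x, x ∉ S → i x = 0 := fun x hx => by simp [i, hx]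
  have hu0 : ∀ x, x ∉ S → u x = 0 := fun x hx =>
    le_antisymm (not_lt.1 (fun h => hx ((hmem x).2 h))) (hu x)
  let v : ι → ℝ := fun x => u x - m * i x
  have hv : ∀ x, 0 ≤ v x := fun x => by
    by_cases hx : x ∈ S
    · simp only [v, hi1 x hx]; linarith [hmin x hx]
    · simp only [v, hi0 x hx, hu0 x hx]; simp
  have hsub : (Finset.univ.filter fun x => 0 < v x) ⊂ S := by
    rw [Finset.ssubset_iff_of_subset]
    · exact ⟨x₀, hx₀, by simp [v, hi1 x₀ hx₀, ← hm]⟩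
    · intro x hx
      by_contra h
      simp [v, hi0 x h, hu0 x h] at hx
  have hind := ih _ (Finset.card_lt_card hsub) v hv
    ((Finset.sum_le_sum_of_subset_of_nonneg hsub.1 fun x _ _ => hp x).trans hsupp) rfl
  have habs : ∀ x y, |u x - u y| = |v x - v y| + m * |i x - i y| := by
    intro x y
    by_cases hx : x ∈ S <;> by_cases hy : y ∈ S
    · simp [v, hi1 x hx, hi1 y hy]
    · have := hmin x hx
      simp only [v, hi1 x hx, hi0 y hy, hu0 y hy]
      rw [abs_of_nonneg (by linarith), abs_of_nonneg (by linarith)]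
      simp
    · have := hmin y hy
      simp only [v, hi1 y hy, hi0 x hx, hu0 x hx]
      rw [abs_of_nonpos (by linarith), abs_of_nonpos (by linarith)]
      simp
    · simp [v, hi0 x hx, hi0 y hy]
  have hsum : ∑ x, p x * u x = ∑ x, p x * v x + m * ∑ x ∈ S, p x := by
    have : ∑ x ∈ S, p x = ∑ x, p x * i x := by
      simp [i, Set.indicator_apply, Finset.sum_ite_mem]
    rw [this, Finset.mul_sum, ← Finset.sum_add_distrib]
    exact Finset.sum_congr rfl fun x _ => by simp only [v]; ring
  have hrhs : ∑ x, ∑ y, w x y * |u x - u y|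
      = ∑ x, ∑ y, w x y * |v x - v y| + m * ∑ x, ∑ y, w x y * |i x - i y| := by
    simp only [habs, mul_add, Finset.sum_add_distrib, Finset.mul_sum]
    congr 1
    exact Finset.sum_congr rfl fun x _ => Finset.sum_congr rfl fun y _ => by ring
  have hc := mul_le_mul_of_nonneg_left (hcut S hne hsupp) hmpos.le
  rw [hsum, hrhs]
  change m * _ ≤ m * ∑ x, ∑ y, w x y * |i x - i y| at hc
  linarith

theorem cheeger_of_small_support (p : ι → ℝ) (hp : ∀ x, 0 ≤ p x) (w : ι → ι → ℝ)
    (hw : ∀ x y, 0 ≤ w x y) (φ g : ℝ) (hφ : 0 ≤ φ) (hg : 0 ≤ g)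
    (hdeg : ∀ x, g * ∑ y, (w x y + w y x) ≤ p x)
    (hcut : ∀ S : Finset ι, S.Nonempty → ∑ x ∈ S, p x ≤ 1 / 2 →
      2 * φ * ∑ x ∈ S, p x ≤
        ∑ x, ∑ y, w x y * |(S : Set ι).indicator 1 x - (S : Set ι).indicator 1 y|)
    (h : ι → ℝ) (hh : ∀ x, 0 ≤ h x) (hsupp : ∑ x with 0 < h x, p x ≤ 1 / 2) :
    2 * g * φ ^ 2 * ∑ x, p x * h x ^ 2 ≤ ∑ x, ∑ y, w x y * (h x - h y) ^ 2 := by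
  have hN : 0 ≤ ∑ x, p x * h x ^ 2 :=
    Finset.sum_nonneg fun x _ => mul_nonneg (hp x) (sq_nonneg _)
  have hE : 0 ≤ ∑ x, ∑ y, w x y * (h x - h y) ^ 2 :=
    Finset.sum_nonneg fun x _ => Finset.sum_nonneg fun y _ => mul_nonneg (hw x y) (sq_nonneg _)
  have hco := coarea_of_cut_bound p hp w φ hcut (fun x => h x ^ 2) (fun x => sq_nonneg _) (by
    convert hsupp using 3 with x
    exact ⟨fun hx => (hh x).lt_of_ne fun h0 => by simp [← h0] at hx, fun hx => by positivity⟩)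
  have hCS : (∑ x, ∑ y, w x y * |h x ^ 2 - h y ^ 2|) ^ 2 ≤
      (∑ x, ∑ y, w x y * (h x - h y) ^ 2) * ∑ x, ∑ y, w x y * (h x + h y) ^ 2 := by
    simp only [← Fintype.sum_prod_type']
    refine Finset.sum_sq_le_sum_mul_sum_of_sq_le_mul _
      (fun z _ => mul_nonneg (hw _ _) (sq_nonneg _))
      (fun z _ => mul_nonneg (hw _ _) (sq_nonneg _)) fun z _ => le_of_eq ?_
    rw [mul_pow, sq_abs]; ring
  have hG : g * ∑ x, ∑ y, w x y * (h x + h y) ^ 2 ≤ 2 * ∑ x, p x * h x ^ 2 := by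
    have h1 : ∑ x, ∑ y, w x y * (h x + h y) ^ 2 ≤
        2 * ∑ x, h x ^ 2 * ∑ y, (w x y + w y x) := by
      have h2 : ∑ x, h x ^ 2 * ∑ y, (w x y + w y x)
          = ∑ x, ∑ y, w x y * (h x ^ 2 + h y ^ 2) := by
        simp only [Finset.sum_add_distrib, mul_add, Finset.mul_sum]
        congr 1
        · exact Finset.sum_congr rfl fun x _ => Finset.sum_congr rfl fun y _ => mul_comm _ _
        · rw [Finset.sum_comm]
          exact Finset.sum_congr rfl fun x _ => Finset.sum_congr rfl fun y _ => mul_comm _ _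
      rw [h2, Finset.mul_sum]
      refine Finset.sum_le_sum fun x _ => ?_
      rw [Finset.mul_sum]
      refine Finset.sum_le_sum fun y _ => ?_
      nlinarith [mul_nonneg (hw x y) (sq_nonneg (h x - h y))]
    have h3 : g * ∑ x, h x ^ 2 * ∑ y, (w x y + w y x) ≤ ∑ x, p x * h x ^ 2 := by
      rw [Finset.mul_sum]
      refine Finset.sum_le_sum fun x _ => ?_
      nlinarith [mul_le_mul_of_nonneg_right (hdeg x) (sq_nonneg (h x))]
    nlinarith [mul_le_mul_of_nonneg_left h1 hg]
  generalize (∑ x, p x * h x ^ 2) = N at *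
  generalize (∑ x, ∑ y, w x y * (h x - h y) ^ 2) = E at *
  generalize (∑ x, ∑ y, w x y * (h x + h y) ^ 2) = G at *
  generalize (∑ x, ∑ y, w x y * |h x ^ 2 - h y ^ 2|) = A at *
  rcases hN.eq_or_lt with h0 | hNpos
  · simpa [← h0] using hE
  have hsq : (2 * φ * N) ^ 2 ≤ A ^ 2 := pow_le_pow_left₀ (by positivity) hco 2
  have h4 : N * (2 * g * φ ^ 2 * N) ≤ N * E := by
    nlinarith [mul_le_mul_of_nonneg_left (hsq.trans hCS) hg, mul_le_mul_of_nonneg_left hG hE]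
  exact le_of_mul_le_mul_left h4 hNpos

/-- Cheeger's inequality for a (not necessarily symmetric) flow `w` and a mean-zero function. -/
theorem cheeger_poincare (p : ι → ℝ) (hp : ∀ x, 0 ≤ p x) (hp1 : ∑ x, p x = 1) (w : ι → ι → ℝ)
    (hw : ∀ x y, 0 ≤ w x y) (φ g : ℝ) (hφ : 0 ≤ φ) (hg : 0 ≤ g)
    (hdeg : ∀ x, g * ∑ y, (w x y + w y x) ≤ p x)
    (hcut : ∀ S : Finset ι, S.Nonempty → ∑ x ∈ S, p x ≤ 1 / 2 →
      2 * φ * ∑ x ∈ S, p x ≤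
        ∑ x, ∑ y, w x y * |(S : Set ι).indicator 1 x - (S : Set ι).indicator 1 y|)
    (f : ι → ℝ) (hf : ∑ x, p x * f x = 0) :
    2 * g * φ ^ 2 * ∑ x, p x * f x ^ 2 ≤ ∑ x, ∑ y, w x y * (f x - f y) ^ 2 := by
  rcases isEmpty_or_nonempty ι with hι | hι
  · simp
  obtain ⟨m, hm1, hm2⟩ := exists_weighted_median p f hp1
  have hpos := cheeger_of_small_support p hp w hw φ g hφ hg hdeg hcut
    (fun x => max (f x - m) 0) (fun x => le_max_right _ _) (by simpa using hm1)
  have hneg := cheeger_of_small_support p hp w hw φ g hφ hg hdeg hcut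
    (fun x => max (m - f x) 0) (fun x => le_max_right _ _) (by simpa using hm2)
  have hsplit : ∀ a : ℝ, max (a - m) 0 ^ 2 + max (m - a) 0 ^ 2 = (a - m) ^ 2 := fun a => by
    rcases le_total a m with h | h
    · rw [max_eq_right (by linarith), max_eq_left (by linarith)]; ring
    · rw [max_eq_left (by linarith), max_eq_right (by linarith)]; ring
  have hcontr : ∀ a b : ℝ, (max (a - m) 0 - max (b - m) 0) ^ 2
      + (max (m - a) 0 - max (m - b) 0) ^ 2 ≤ (a - b) ^ 2 := fun a b => by
    rcases le_total a m with h | h <;> rcases le_total b m with h' | h' <;>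
    simp only [max_eq_right (sub_nonpos.2 h), max_eq_left (sub_nonneg.2 h),
      max_eq_right (sub_nonpos.2 h'), max_eq_left (sub_nonneg.2 h')] <;>
    nlinarith [mul_nonneg (sub_nonneg.2 h) (sub_nonneg.2 h')]
  have hvar : ∑ x, p x * f x ^ 2 ≤
      ∑ x, p x * max (f x - m) 0 ^ 2 + ∑ x, p x * max (m - f x) 0 ^ 2 := by
    rw [← Finset.sum_add_distrib]
    simp only [← mul_add, hsplit]
    have : ∑ x, p x * (f x - m) ^ 2
        = ∑ x, p x * f x ^ 2 - 2 * m * ∑ x, p x * f x + m ^ 2 * ∑ x, p x := by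
      rw [Finset.mul_sum, Finset.mul_sum, ← Finset.sum_sub_distrib, ← Finset.sum_add_distrib]
      exact Finset.sum_congr rfl fun x _ => by ring
    rw [this, hf, hp1]
    nlinarith [sq_nonneg m]
  have hE : ∑ x, ∑ y, w x y * (max (f x - m) 0 - max (f y - m) 0) ^ 2
      + ∑ x, ∑ y, w x y * (max (m - f x) 0 - max (m - f y) 0) ^ 2
      ≤ ∑ x, ∑ y, w x y * (f x - f y) ^ 2 := by
    simp only [← Finset.sum_add_distrib, ← mul_add]
    exact Finset.sum_le_sum fun x _ => Finset.sum_le_sum fun y _ =>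
      mul_le_mul_of_nonneg_left (hcontr _ _) (hw x y)
  have := mul_le_mul_of_nonneg_left hvar (show 0 ≤ 2 * g * φ ^ 2 by positivity)
  linarith

/-- Quantitative Cauchy-Schwarz: the variance of `f` under the weights `a` is at least the
contribution of the pairs containing `y`. -/
theorem mul_sum_sq_sub_le_variance [DecidableEq ι] (a f : ι → ℝ) (ha : ∀ x, 0 ≤ a x) (y : ι) :
    a y * ∑ x, a x * (f x - f y) ^ 2 ≤ (∑ x, a x) * ∑ x, a x * f x ^ 2 - (∑ x, a x * f x) ^ 2 := by
  have hCS : (∑ x ∈ Finset.univ.erase y, a x * (f x - f y)) ^ 2 ≤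
      (∑ x ∈ Finset.univ.erase y, a x) * ∑ x ∈ Finset.univ.erase y, a x * (f x - f y) ^ 2 :=
    Finset.sum_sq_le_sum_mul_sum_of_sq_le_mul _ (fun z _ => ha z)
      (fun z _ => mul_nonneg (ha z) (sq_nonneg _)) fun z _ => le_of_eq (by ring)
  have e0 := Finset.add_sum_erase Finset.univ a (Finset.mem_univ y)
  have e1 := Finset.add_sum_erase Finset.univ (fun x => a x * (f x - f y)) (Finset.mem_univ y)
  have e2 := Finset.add_sum_erase Finset.univ (fun x => a x * (f x - f y) ^ 2) (Finset.mem_univ y)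
  simp only [sub_self, mul_zero, zero_add, ne_eq, OfNat.ofNat_ne_zero, not_false_eq_true,
    zero_pow] at e1 e2
  rw [e1, e2] at hCS
  have h1 : ∑ x, a x * (f x - f y) = ∑ x, a x * f x - f y * ∑ x, a x := by
    rw [Finset.mul_sum, ← Finset.sum_sub_distrib]
    exact Finset.sum_congr rfl fun x _ => by ring
  have h2 : ∑ x, a x * (f x - f y) ^ 2
      = ∑ x, a x * f x ^ 2 - 2 * f y * ∑ x, a x * f x + f y ^ 2 * ∑ x, a x := by
    rw [Finset.mul_sum, Finset.mul_sum, ← Finset.sum_sub_distrib, ← Finset.sum_add_distrib]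
    exact Finset.sum_congr rfl fun x _ => by ring
  have h3 : (∑ x, a x) * ∑ x, a x * f x ^ 2 - (∑ x, a x * f x) ^ 2
      = (∑ x, a x) * ∑ x, a x * (f x - f y) ^ 2 - (∑ x, a x * (f x - f y)) ^ 2 := by
    rw [h1, h2]; ring
  rw [h3, ← e0]
  linarith

/-- One step of a lazy chain contracts the `L²` norm of mean-zero densities. -/
theorem lazy_chi_sq_contraction (p q : ι → ℝ) (hp : ∀ x, 0 < p x)
    (hp1 : ∑ x, p x = 1) (hq : ∀ x, 0 < q x) (P : ι → ι → ℝ) (hP : ∀ x y, 0 ≤ P x y)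
    (hP1 : ∀ x, ∑ y, P x y = 1) (hlazy : ∀ x, 1 / 2 ≤ P x x)
    (hstep : ∀ y, ∑ x, p x * P x y = q y) (φ g : ℝ) (hφ : 0 ≤ φ) (hg : 0 ≤ g)
    (hgq : ∀ x, g * q x ≤ p x)
    (hcut : ∀ S : Finset ι, S.Nonempty → ∑ x ∈ S, p x ≤ 1 / 2 →
      2 * φ * ∑ x ∈ S, p x ≤
        ∑ x, ∑ y, p x * P x y * |(S : Set ι).indicator 1 x - (S : Set ι).indicator 1 y|)
    (f : ι → ℝ) (hf : ∑ x, p x * f x = 0) :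
    ∑ y, q y * ((∑ x, p x * P x y * f x) / q y) ^ 2 ≤
      (1 - g ^ 2 * φ ^ 2) * ∑ x, p x * f x ^ 2 := by
  classical
  let w : ι → ι → ℝ := fun x y => if x = y then 0 else p x * P x y
  have hQ : ∀ x y, 0 ≤ p x * P x y := fun x y => mul_nonneg (hp x).le (hP x y)
  have hw : ∀ x y, 0 ≤ w x y := fun x y => by
    by_cases h : x = y <;> simp [w, h, hQ]
  have hwE : ∀ F : ι → ι → ℝ, (∀ x, F x x = 0) →
      ∑ x, ∑ y, w x y * F x y = ∑ x, ∑ y, p x * P x y * F x y := fun F hF =>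
    Finset.sum_congr rfl fun x _ => Finset.sum_congr rfl fun y _ => by
      by_cases h : x = y <;> simp [w, h, hF]
  have hrow : ∀ x, ∑ y, w x y = p x - p x * P x x := fun x => by
    have : ∀ y, w x y = p x * P x y - if x = y then p x * P x x else 0 := fun y => by
      by_cases h : x = y <;> simp [w, h]
    simp only [this, Finset.sum_sub_distrib, ← Finset.mul_sum, hP1]
    simp
  have hcol : ∀ x, ∑ y, w y x = q x - p x * P x x := fun x => by
    have : ∀ y, w y x = p y * P y x - if y = x then p x * P x x else 0 := fun y => by
      by_cases h : y = x <;> simp [w, h]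
    simp only [this, Finset.sum_sub_distrib, hstep]
    simp
  have hdeg : ∀ x, g * ∑ y, (w x y + w y x) ≤ p x := fun x => by
    rw [Finset.sum_add_distrib, hrow, hcol]
    refine le_trans (mul_le_mul_of_nonneg_left ?_ hg) (hgq x)
    nlinarith [mul_le_mul_of_nonneg_left (hlazy x) (hp x).le]
  have hch := cheeger_poincare p (fun x => (hp x).le) hp1 w hw φ g hφ hg hdeg
    (fun S hS hS' => by
      rw [hwE (fun x y => |(S : Set ι).indicator 1 x - (S : Set ι).indicator 1 y|)
        (fun x => by simp)]
      exact hcut S hS hS') f hf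
  rw [hwE (fun x y => (f x - f y) ^ 2) (fun x => by simp)] at hch
  have hcolumn : ∀ y, q y * ((∑ x, p x * P x y * f x) / q y) ^ 2 ≤
      ∑ x, p x * P x y * f x ^ 2 - g / 2 * ∑ x, p x * P x y * (f x - f y) ^ 2 := fun y => by
    have hv := mul_sum_sq_sub_le_variance (fun x => p x * P x y) f (fun x => hQ x y) y
    simp only [hstep] at hv
    have hV : 0 ≤ ∑ x, p x * P x y * (f x - f y) ^ 2 :=
      Finset.sum_nonneg fun x _ => mul_nonneg (hQ x y) (sq_nonneg _)
    have hhold : g / 2 * q y ≤ p y * P y y := by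
      nlinarith [mul_le_mul_of_nonneg_left (hlazy y) (hp y).le, hgq y]
    have he : q y * ((∑ x, p x * P x y * f x) / q y) ^ 2
        = (∑ x, p x * P x y * f x) ^ 2 / q y := by
      have := (hq y).ne'
      field_simp
    rw [he, div_le_iff₀ (hq y)]
    nlinarith [mul_le_mul_of_nonneg_right hhold hV]
  have htot : ∑ y, ∑ x, p x * P x y * f x ^ 2 = ∑ x, p x * f x ^ 2 := by
    rw [Finset.sum_comm]
    refine Finset.sum_congr rfl fun x _ => ?_
    rw [← Finset.sum_mul, ← Finset.mul_sum, hP1, mul_one]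
  calc _ ≤ ∑ y, (∑ x, p x * P x y * f x ^ 2 - g / 2 * ∑ x, p x * P x y * (f x - f y) ^ 2) :=
        Finset.sum_le_sum fun y _ => hcolumn y
    _ = ∑ x, p x * f x ^ 2 - g / 2 * ∑ x, ∑ y, p x * P x y * (f x - f y) ^ 2 := by
        rw [Finset.sum_sub_distrib, htot, ← Finset.mul_sum,
          Finset.sum_comm (f := fun y x => p x * P x y * (f x - f y) ^ 2)]
    _ ≤ _ := by nlinarith [mul_le_mul_of_nonneg_left hch (show 0 ≤ g / 2 by linarith)]

end Cheeger

section Chain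

variable {n : ℕ} {P : ℤ → Matrix (Fin n) (Fin n) ℝ} {π : ℤ → Fin n → ℝ}

theorem mprod_self (s : ℤ) : mprod n P s s = 1 := by simp [mprod]

theorem mprod_eq_mul {s t : ℤ} (h : s < t) : mprod n P s t = mprod n P s (t - 1) * P t := by
  obtain ⟨k, rfl⟩ : ∃ k : ℕ, t = s + 1 + k := ⟨(t - s - 1).toNat, by omega⟩
  have h1 : (s + 1 + (k : ℤ) - s).toNat = k + 1 := by omega
  have h2 : (s + 1 + (k : ℤ) - 1 - s).toNat = k := by omega
  simp [mprod, h1, h2, List.range_succ]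

theorem mprod_sum_eq_one (hP : ∀ s x, ∑ y, P s x y = 1) (s : ℤ) (k : ℕ) (x : Fin n) :
    ∑ y, mprod n P s (s + k) x y = 1 := by
  induction k with
  | zero => simp [mprod_self, Matrix.one_apply]
  | succ k ih =>
    rw [mprod_eq_mul (by omega), show s + ((k + 1 : ℕ) : ℤ) - 1 = s + k by push_cast; ring]
    simp only [Matrix.mul_apply]
    rw [Finset.sum_comm]
    simpa only [← Finset.mul_sum, hP, mul_one] using ih

theorem IsTarget.step (hn : 1 ≤ n) (hπ : IsTarget n P π) (s : ℤ) (y : Fin n) :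
    ∑ x, π (s - 1) x * P s x y = π s y := by
  let x₀ : Fin n := ⟨0, hn⟩
  have h1 : Tendsto (fun r : ℤ => ∑ x, mprod n P r (s - 1) x₀ x * P s x y) atBot
      (nhds (∑ x, π (s - 1) x * P s x y)) :=
    tendsto_finsetSum _ fun x _ => ((hπ (s - 1)).2.2 x₀ x).mul_const _
  refine tendsto_nhds_unique (h1.congr' ?_) ((hπ s).2.2 x₀ y)
  filter_upwards [eventually_lt_atBot s] with r hr
  rw [mprod_eq_mul hr, Matrix.mul_apply]

theorem IsTarget.unique (hn : 1 ≤ n) {π' : ℤ → Fin n → ℝ} (hπ : IsTarget n P π)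
    (hπ' : IsTarget n P π') : π = π' := by
  funext s z
  exact tendsto_nhds_unique ((hπ s).2.2 ⟨0, hn⟩ z) ((hπ' s).2.2 ⟨0, hn⟩ z)

theorem flowQ_nonneg (hP : ∀ s x y, 0 ≤ P s x y) (hpos : ∀ s z, 0 < π s z) (s : ℤ)
    (A B : Finset (Fin n)) : 0 ≤ flowQ n P π s A B :=
  Finset.sum_nonneg fun x _ => Finset.sum_nonneg fun y _ => mul_nonneg (hpos _ x).le (hP s x y)

theorem bigPhi_nonneg (hP : ∀ s x y, 0 ≤ P s x y) (hpos : ∀ s z, 0 < π s z) (s : ℤ)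
    (S : Finset (Fin n)) : 0 ≤ bigPhi n P π s S :=
  div_nonneg (add_nonneg (flowQ_nonneg hP hpos s _ _) (flowQ_nonneg hP hpos s _ _))
    (mul_nonneg zero_le_two (Finset.sum_nonneg fun x _ => (hpos _ x).le))

theorem bigPhiStar_nonneg (hP : ∀ s x y, 0 ≤ P s x y) (hpos : ∀ s z, 0 < π s z) (s : ℤ) :
    0 ≤ bigPhiStar n P π s := by
  refine Real.sInf_nonneg ?_
  rintro r ⟨S, -, -, rfl⟩
  exact bigPhi_nonneg hP hpos s S

theorem bigPhiStar_cut_bound (hP : ∀ s x y, 0 ≤ P s x y) (hpos : ∀ s z, 0 < π s z) (s : ℤ)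
    (S : Finset (Fin n)) (hS : S.Nonempty) (hhalf : ∑ x ∈ S, π (s - 1) x ≤ 1 / 2) :
    2 * bigPhiStar n P π s * ∑ x ∈ S, π (s - 1) x ≤ ∑ x, ∑ y, π (s - 1) x * P s x y *
      |(S : Set (Fin n)).indicator 1 x - (S : Set (Fin n)).indicator 1 y| := by
  have hle : bigPhiStar n P π s ≤ bigPhi n P π s S :=
    csInf_le ⟨0, by rintro r ⟨S, -, -, rfl⟩; exact bigPhi_nonneg hP hpos s S⟩ ⟨S, hS, hhalf, rfl⟩
  have hSpos : 0 < ∑ x ∈ S, π (s - 1) x := Finset.sum_pos (fun x _ => hpos _ x) hS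
  have hflow : ∑ x, ∑ y, π (s - 1) x * P s x y *
      |(S : Set (Fin n)).indicator 1 x - (S : Set (Fin n)).indicator 1 y|
      = flowQ n P π s S Sᶜ + flowQ n P π s Sᶜ S := by
    unfold flowQ
    rw [← Finset.sum_add_sum_compl S]
    congr 1
    · refine Finset.sum_congr rfl fun x hx => ?_
      rw [← Finset.sum_add_sum_compl S, Finset.sum_eq_zero, zero_add]
      · refine Finset.sum_congr rfl fun y hy => ?_
        simp [hx, Finset.mem_compl.1 hy]
      · intro y hy
        simp [hx, hy]
    · refine Finset.sum_congr rfl fun x hx => ?_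
      rw [← Finset.sum_add_sum_compl S, Finset.sum_eq_zero (s := Sᶜ), add_zero]
      · refine Finset.sum_congr rfl fun y hy => ?_
        simp [hy, Finset.mem_compl.1 hx]
      · intro y hy
        simp [Finset.mem_compl.1 hx, Finset.mem_compl.1 hy]
  rw [hflow]
  rw [bigPhi, le_div_iff₀ (by positivity)] at hle
  linarith

theorem gq_nonneg (hpos : ∀ s z, 0 < π s z) (s : ℤ) : 0 ≤ gq n π s :=
  Real.iInf_nonneg fun z => (div_pos (hpos _ z) (hpos _ z)).le

theorem gq_mul_le (hpos : ∀ s z, 0 < π s z) (s : ℤ) (z : Fin n) :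
    gq n π s * π s z ≤ π (s - 1) z :=
  (le_div_iff₀ (hpos s z)).1 (ciInf_le (Set.finite_range _).bddBelow z)

theorem gq_le_one (hsum : ∀ s, ∑ z, π s z = 1) (hpos : ∀ s z, 0 < π s z) (s : ℤ) :
    gq n π s ≤ 1 := by
  have := Finset.sum_le_sum fun z (_ : z ∈ Finset.univ) => gq_mul_le hpos s z
  rwa [← Finset.mul_sum, hsum, hsum, mul_one] at this

theorem theta_le_sq (hsum : ∀ s, ∑ z, π s z = 1) (hP : ∀ s x y, 0 ≤ P s x y)
    (hpos : ∀ s z, 0 < π s z) {s t : ℕ} (hs : 1 ≤ s) (hst : s ≤ t) :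
    theta n P π t ≤ gq n π s ^ 2 * bigPhiStar n P π s ^ 2 := by
  have hle : theta n P π t ≤
      ((1 / 2) * (gq n π s / (1 - gq n π s / 2)) * bigPhiStar n P π s) ^ 2 :=
    csInf_le ⟨0, by rintro r ⟨_, -, -, rfl⟩; exact sq_nonneg _⟩ ⟨s, hs, hst, rfl⟩
  have hg0 := gq_nonneg hpos (s : ℤ)
  have hg1 := gq_le_one hsum hpos (s : ℤ)
  have hφ := bigPhiStar_nonneg hP hpos (s : ℤ)
  refine hle.trans ?_
  rw [← mul_pow]
  have hden : 0 < 1 - gq n π s / 2 := by linarith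
  have hfrac : (1 / 2) * (gq n π s / (1 - gq n π s / 2)) ≤ gq n π s := by
    rw [mul_div_assoc', div_le_iff₀ hden]
    nlinarith
  exact pow_le_pow_left₀ (mul_nonneg (mul_nonneg (by norm_num) (div_nonneg hg0 hden.le)) hφ)
    (mul_le_mul_of_nonneg_right hfrac hφ) 2

theorem chi_sq_decay (hn : 1 ≤ n) (hP : ∀ s : ℤ, (∀ x y, 0 ≤ P s x y) ∧ (∀ x, ∑ y, P s x y = 1) ∧
      ∀ x, (1:ℝ)/2 ≤ P s x x)
    (hπ : IsTarget n P π) (hpos : ∀ s z, 0 < π s z) {κ : ℝ} (x : Fin n) (t : ℕ)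
    (hΘ : ∀ s : ℕ, 1 ≤ s → s ≤ t → κ ≤ theta n P π s) :
    ∑ z, π t z * (mprod n P 0 t x z / π t z - 1) ^ 2 ≤ Real.exp (-(κ * t)) * (π 0 x)⁻¹ := by
  have hsum : ∀ s, ∑ z, π s z = 1 := fun s => (hπ s).2.1
  induction t with
  | zero =>
    have h : ∀ z, π 0 z * (mprod n P 0 0 x z / π 0 z - 1) ^ 2
        = (if x = z then (π 0 z)⁻¹ - 2 else 0) + π 0 z := fun z => by
      have := (hpos 0 z).ne'
      by_cases hz : x = z
      · simp only [mprod_self, Matrix.one_apply, hz, if_true]; field_simp; ring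
      · simp [mprod_self, hz]
    simp only [Nat.cast_zero, h, Finset.sum_add_distrib, hsum, Finset.sum_ite_eq, Finset.mem_univ,
      if_true, mul_zero, neg_zero, Real.exp_zero, one_mul]
    linarith
  | succ t ih =>
    have ih := ih fun s hs hst => hΘ s hs (hst.trans t.le_succ)
    have hcast : ((t + 1 : ℕ) : ℤ) - 1 = t := by push_cast; ring
    set T : ℤ := ((t + 1 : ℕ) : ℤ) with hT
    let f : Fin n → ℝ := fun z => mprod n P 0 t x z / π t z - 1
    have hpf : ∀ z, π t z * f z = mprod n P 0 t x z - π t z := fun z => by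
      have := (hpos t z).ne'
      simp only [f]; field_simp
    have hf : ∑ z, π (T - 1) z * f z = 0 := by
      have h1 := mprod_sum_eq_one (fun s => (hP s).2.1) 0 t x
      rw [zero_add] at h1
      simp only [hcast, hpf, Finset.sum_sub_distrib, hsum, h1, sub_self]
    have hstep := lazy_chi_sq_contraction (π (T - 1)) (π T) (hpos _) (hsum _) (hpos _) (P T)
      (hP T).1 (hP T).2.1 (hP T).2.2 (hπ.step hn T) (bigPhiStar n P π T) (gq n π T)
      (bigPhiStar_nonneg (fun s => (hP s).1) hpos T) (gq_nonneg hpos T) (gq_mul_le hpos T)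
      (bigPhiStar_cut_bound (fun s => (hP s).1) hpos T) f hf
    have hnew : ∀ y, (∑ z, π (T - 1) z * P T z y * f z) / π T y
        = mprod n P 0 T x y / π T y - 1 := fun y => by
      have h1 : ∑ z, π (T - 1) z * P T z y * f z = mprod n P 0 T x y - π T y := by
        rw [← hπ.step hn T y, mprod_eq_mul (show (0 : ℤ) < T by omega), Matrix.mul_apply,
          ← Finset.sum_sub_distrib, hcast]
        exact Finset.sum_congr rfl fun z _ => by linear_combination P T z y * hpf z
      rw [h1, sub_div, div_self (hpos T y).ne']
    simp only [hnew] at hstep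
    have hκ : κ ≤ gq n π T ^ 2 * bigPhiStar n P π T ^ 2 :=
      (hΘ (t + 1) (by omega) le_rfl).trans
        (theta_le_sq hsum (fun s => (hP s).1) hpos (by omega) le_rfl)
    have hV : 0 ≤ ∑ z, π (T - 1) z * f z ^ 2 :=
      Finset.sum_nonneg fun z _ => mul_nonneg (hpos _ z).le (sq_nonneg _)
    have hexp : 1 - gq n π T ^ 2 * bigPhiStar n P π T ^ 2 ≤ Real.exp (-κ) := by
      have := Real.add_one_le_exp (-κ)
      linarith
    calc _ ≤ Real.exp (-κ) * ∑ z, π (T - 1) z * f z ^ 2 :=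
          hstep.trans (mul_le_mul_of_nonneg_right hexp hV)
      _ ≤ Real.exp (-κ) * (Real.exp (-(κ * t)) * (π 0 x)⁻¹) := by
          rw [hcast]
          exact mul_le_mul_of_nonneg_left ih (Real.exp_pos _).le
      _ = _ := by
          rw [← mul_assoc, ← Real.exp_add]
          push_cast
          ring_nf

theorem dTV_le_of_chi_sq (hn : 1 ≤ n) (hπ : IsTarget n P π) (hpos : ∀ s z, 0 < π s z) {ε : ℝ}
    (hε : 0 ≤ ε) (t : ℤ)
    (h : ∀ x, ∑ z, π t z * (mprod n P 0 t x z / π t z - 1) ^ 2 ≤ (2 * ε) ^ 2) :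
    dTV n P π 0 t ≤ ε := by
  have : Nonempty (Fin n) := ⟨⟨0, hn⟩⟩
  refine ciSup_le fun x => ?_
  have hCS : (∑ z, |mprod n P 0 t x z - π t z|) ^ 2 ≤
      (∑ z, π t z) * ∑ z, π t z * (mprod n P 0 t x z / π t z - 1) ^ 2 :=
    Finset.sum_sq_le_sum_mul_sum_of_sq_le_mul _ (fun z _ => (hpos t z).le)
      (fun z _ => mul_nonneg (hpos t z).le (sq_nonneg _)) fun z _ => le_of_eq (by
        have := (hpos t z).ne'
        rw [sq_abs]; field_simp)
  rw [(hπ t).2.1, one_mul] at hCS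
  have := abs_le_of_sq_le_sq (hCS.trans (h x)) (by positivity)
  linarith [le_of_abs_le this]

/-- Deterministic mixing bound: `t` steps suffice once `t` exceeds the logarithmic threshold. -/
theorem dTV_le_of_theta_ge (hn : 1 ≤ n)
    (hP : ∀ s : ℤ, (∀ x y, 0 ≤ P s x y) ∧ (∀ x, ∑ y, P s x y = 1) ∧ ∀ x, (1:ℝ)/2 ≤ P s x x)
    (hπ : IsTarget n P π) (hpos : ∀ s z, 0 < π s z) {β κ ε : ℝ} (hβ : 0 < β) (hκ : 0 < κ)
    (hε : 0 < ε) (hmin : ∀ z, (n : ℝ) ^ (-β) ≤ π 0 z) (t : ℕ)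
    (hΘ : ∀ s : ℕ, 1 ≤ s → s ≤ t → κ ≤ theta n P π s)
    (ht : (2 / κ) * (Real.log ((n : ℝ) ^ β / 2) + Real.log ε⁻¹) ≤ t) :
    dTV n P π 0 t ≤ ε := by
  have hn1 : (1 : ℝ) ≤ n := by exact_mod_cast hn
  have hN1 : 1 ≤ (n : ℝ) ^ β := Real.one_le_rpow hn1 hβ.le
  refine dTV_le_of_chi_sq hn hπ hpos hε.le t fun x => (chi_sq_decay hn hP hπ hpos x t hΘ).trans ?_
  have hinv : (π 0 x)⁻¹ ≤ (n : ℝ) ^ β := by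
    have := hmin x
    rw [Real.rpow_neg (by linarith)] at this
    exact inv_le_of_inv_le₀ (by linarith) this
  set N := (n : ℝ) ^ β
  have hN : 0 < N := by linarith
  have hexp : Real.exp (-(κ * t)) ≤ (2 * ε / N) ^ 2 := by
    rw [← Real.le_log_iff_exp_le (by positivity), Real.log_pow, Real.log_div (by positivity) hN.ne',
      Real.log_mul two_ne_zero hε.ne']
    rw [Real.log_div hN.ne' two_ne_zero, Real.log_inv, div_mul_eq_mul_div, div_le_iff₀ hκ] at ht
    push_cast
    linarith
  calc _ ≤ (2 * ε / N) ^ 2 * N := mul_le_mul hexp hinv (inv_nonneg.2 (hpos 0 x).le) (sq_nonneg _)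
    _ = (2 * ε) ^ 2 / N := by field_simp
    _ ≤ _ := div_le_self (sq_nonneg _) hN1

end Chain

section Probability

theorem measurable_mprod_apply (n : ℕ) (s : ℤ) (k : ℕ) (x y : Fin n) :
    Measurable fun ω : ℤ → Matrix (Fin n) (Fin n) ℝ => mprod n ω s (s + k) x y := by
  induction k generalizing y with
  | zero => simp only [Nat.cast_zero, add_zero, mprod_self]; exact measurable_const
  | succ k ih =>
    have h : ∀ ω : ℤ → Matrix (Fin n) (Fin n) ℝ, mprod n ω s (s + (k + 1 : ℕ)) x y
        = ∑ z, mprod n ω s (s + k) x z * ω (s + (k + 1 : ℕ)) z y := fun ω => by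
      rw [mprod_eq_mul (by omega), show s + ((k + 1 : ℕ) : ℤ) - 1 = s + k by push_cast; ring,
        Matrix.mul_apply]
    simp only [h]
    refine Finset.measurable_sum _ fun z _ => (ih z).mul ?_
    exact (measurable_pi_apply y).comp ((measurable_pi_apply z).comp (measurable_pi_apply _))

theorem nullMeasurableSet_target_min {n : ℕ} (hn : 1 ≤ n)
    (μ : Measure (ℤ → Matrix (Fin n) (Fin n) ℝ)) (h : ∀ᵐ ω ∂μ, ∃ π, IsTarget n ω π) (c : ℝ) :
    NullMeasurableSet {ω | ∃ π : ℤ → Fin n → ℝ, IsTarget n ω π ∧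
      ∀ t : ℕ, t ≤ n → c ≤ ⨅ z : Fin n, π t z} μ := by
  classical
  have : Nonempty (Fin n) := ⟨⟨0, hn⟩⟩
  let p : (ℤ → Matrix (Fin n) (Fin n) ℝ) → ℤ → Fin n → ℝ := fun ω =>
    if hω : ∃ π, IsTarget n ω π then hω.choose else 0
  have hp : ∀ ω, (∃ π, IsTarget n ω π) → IsTarget n ω (p ω) := fun ω hω => by
    simp only [p, dif_pos hω]; exact hω.choose_spec
  have hmeas : ∀ t z, AEMeasurable (fun ω => p ω t z) μ := fun t z => by
    refine aemeasurable_of_tendsto_metrizable_ae atTop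
      (f := fun (k : ℕ) ω => mprod n ω (t - k) t ⟨0, hn⟩ z) (fun k => ?_) ?_
    · have := measurable_mprod_apply n (t - k) k ⟨0, hn⟩ z
      rw [sub_add_cancel] at this
      exact this.aemeasurable
    · filter_upwards [h] with ω hω
      refine ((hp ω hω t).2.2 ⟨0, hn⟩ z).comp ?_
      simp only [sub_eq_add_neg]
      exact tendsto_atBot_add_const_left _ _
        (tendsto_neg_atTop_atBot.comp tendsto_natCast_atTop_atTop)
  have hset : NullMeasurableSet {ω | ∀ t : ℕ, t ≤ n → ∀ z, c ≤ p ω t z} μ := by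
    simp only [Set.ofPred_forall]
    exact NullMeasurableSet.iInter fun t => NullMeasurableSet.iInter fun _ =>
      NullMeasurableSet.iInter fun z => nullMeasurableSet_le aemeasurable_const (hmeas t z)
  refine hset.congr ?_
  filter_upwards [h] with ω hω
  refine propext ⟨fun H => ⟨p ω, hp ω hω, fun t ht => le_ciInf (H t ht)⟩, ?_⟩
  rintro ⟨π, hπ, H⟩ t ht z
  rw [← hπ.unique hn (hp ω hω)]
  exact (H t ht).trans (ciInf_le (Set.finite_range _).bddBelow z)

/-- If two events have probability tending to one and the first is eventually measurable, so does
any event eventually containing their intersection almost surely. -/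
theorem tendsto_measure_one_of_inter {Ω : ℕ → Type*} [∀ n, MeasurableSpace (Ω n)]
    (μ : ∀ n, Measure (Ω n)) (hprob : ∀ n, IsProbabilityMeasure (μ n)) (A B C : ∀ n, Set (Ω n))
    (hA : Tendsto (fun n => μ n (A n)) atTop (nhds 1))
    (hB : Tendsto (fun n => μ n (B n)) atTop (nhds 1))
    (hAm : ∀ᶠ n in atTop, NullMeasurableSet (A n) (μ n))
    (hC : ∀ᶠ n in atTop, ∀ᵐ ω ∂ μ n, ω ∈ A n → ω ∈ B n → ω ∈ C n) :
    Tendsto (fun n => μ n (C n)) atTop (nhds 1) := by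
  have hlow : Tendsto (fun n => μ n (B n) - (1 - μ n (A n))) atTop (nhds 1) := by
    have h0 : Tendsto (fun n => 1 - μ n (A n)) atTop (nhds 0) := by
      simpa using ENNReal.Tendsto.sub (tendsto_const_nhds (x := (1 : ENNReal))) hA (by simp)
    simpa using ENNReal.Tendsto.sub hB h0 (by simp)
  refine tendsto_of_tendsto_of_tendsto_of_le_of_le' hlow tendsto_const_nhds ?_
    (Eventually.of_forall fun n => prob_le_one)
  filter_upwards [hAm, hC] with n hm hc
  rw [← prob_compl_eq_one_sub₀ hm, tsub_le_iff_right]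
  calc μ n (B n) ≤ μ n (C n ∪ (A n)ᶜ) := measure_mono_ae (by
        filter_upwards [hc] with ω hω hωB
        by_cases hωA : ω ∈ A n
        · exact Or.inl (hω hωA hωB)
        · exact Or.inr hωA)
    _ ≤ _ := measure_union_le _ _

theorem tendsto_log_rpow_div_two {β : ℝ} (hβ : 0 < β) :
    Tendsto (fun n : ℕ => Real.log ((n : ℝ) ^ β / 2)) atTop atTop :=
  Real.tendsto_log_atTop.comp
    (((tendsto_rpow_atTop hβ).comp tendsto_natCast_atTop_atTop).atTop_div_const two_pos)

theorem eventually_mixing_threshold_le (β κ ε : ℝ) :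
    ∀ᶠ n : ℕ in atTop,
      1 + (2 / κ) * (Real.log ((n : ℝ) ^ β / 2) + Real.log ε⁻¹) ≤ n := by
  have hlog : Tendsto (fun x : ℝ => Real.log x / x) atTop (nhds 0) :=
    Real.isLittleO_log_id_atTop.tendsto_div_nhds_zero
  have hinv := tendsto_inv_atTop_zero (𝕜 := ℝ)
  have h := ((hlog.const_mul (2 / κ * β)).add
    (hinv.const_mul (1 + (2 / κ) * (Real.log ε⁻¹ - Real.log 2)))).comp
    (tendsto_natCast_atTop_atTop (R := ℝ))
  simp only [mul_zero, add_zero] at h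
  filter_upwards [h.eventually_le_const one_pos, eventually_ge_atTop 1] with n hn hn1
  have hn0 : (0 : ℝ) < n := by exact_mod_cast hn1
  rw [Real.log_div (Real.rpow_pos_of_pos hn0 β).ne' two_ne_zero, Real.log_rpow hn0]
  have := mul_le_mul_of_nonneg_right hn hn0.le
  simp only [Function.comp_apply, one_mul] at this
  refine le_trans (le_of_eq ?_) this
  field_simp
  ring

end Probability

/-- High-probability mixing bound (Corollary 4.2): if w.h.p. `π_t^min ≥ n^{−β}` and
`Θ_t ≥ κ` for every `t ∈ {0,…,n}`, then for every `ε ∈ (0,1)`, w.h.p. the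
`ε`-mixing time at time `0` is at most `1 + (2/κ)[log(n^β/2) + log ε⁻¹]`
(i.e. w.h.p. there is such a time `t` with `d(0,t) ≤ ε`). -/
theorem whp_mixing_bound
    (μ : (n : ℕ) → Measure (ℤ → Matrix (Fin n) (Fin n) ℝ))
    (hprob : ∀ n, IsProbabilityMeasure (μ n))
    (has : ∀ n, 1 ≤ n → ∀ᵐ ω ∂ μ n,
      (∀ s : ℤ, (∀ x y, 0 ≤ ω s x y) ∧ (∀ x, ∑ y, ω s x y = 1) ∧ ∀ x, (1:ℝ)/2 ≤ ω s x x) ∧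
      ∃ π : ℤ → Fin n → ℝ, IsTarget n ω π ∧ ∀ s z, 0 < π s z)
    (β κ : ℝ) (hβ : 0 < β) (hκ : 0 < κ)
    (hπmin : Tendsto (fun n : ℕ => μ n {ω | ∃ π : ℤ → Fin n → ℝ, IsTarget n ω π ∧
        ∀ t : ℕ, t ≤ n → (n : ℝ) ^ (-β) ≤ ⨅ z : Fin n, π t z})
      atTop (nhds 1))
    (hΘ : Tendsto (fun n : ℕ => μ n {ω | ∃ π : ℤ → Fin n → ℝ, IsTarget n ω π ∧
        ∀ t : ℕ, 1 ≤ t → t ≤ n → κ ≤ theta n ω π t})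
      atTop (nhds 1)) :
    ∀ ε ∈ Set.Ioo (0:ℝ) 1,
      Tendsto (fun n : ℕ => μ n {ω | ∃ π : ℤ → Fin n → ℝ, IsTarget n ω π ∧
          ∃ t : ℕ, dTV n ω π 0 t ≤ ε ∧
            (t : ℝ) ≤ 1 + (2 / κ) * (Real.log ((n : ℝ) ^ β / 2) + Real.log ε⁻¹)})
        atTop (nhds 1) := by
  intro ε hε
  refine tendsto_measure_one_of_inter μ hprob _ _ _ hπmin hΘ ?_ ?_
  · filter_upwards [eventually_ge_atTop 1] with n hn
    refine nullMeasurableSet_target_min hn (μ n) ?_ _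
    filter_upwards [has n hn] with ω hω
    exact ⟨hω.2.choose, hω.2.choose_spec.1⟩
  filter_upwards [eventually_ge_atTop 1, eventually_mixing_threshold_le β κ ε,
    (tendsto_log_rpow_div_two hβ).eventually_ge_atTop 0] with n hn hthr hlog
  filter_upwards [has n hn] with ω hω
  rintro ⟨π₁, hπ₁, hmin⟩ ⟨π₂, hπ₂, hκΘ⟩
  obtain ⟨hP, π, hπ, hpos⟩ := hω
  obtain rfl := hπ₁.unique hn hπ
  obtain rfl := hπ₂.unique hn hπ
  set X := (2 / κ) * (Real.log ((n : ℝ) ^ β / 2) + Real.log ε⁻¹)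
  have hX : 0 ≤ X := mul_nonneg (by positivity)
    (add_nonneg hlog (Real.log_nonneg ((one_le_inv₀ hε.1).2 hε.2.le)))
  have hceil : (⌈X⌉₊ : ℝ) ≤ 1 + X := by linarith [Nat.ceil_lt_add_one hX]
  have hceil_n : ⌈X⌉₊ ≤ n := by exact_mod_cast hceil.trans hthr
  refine ⟨_, hπ, ⌈X⌉₊, ?_, hceil⟩
  refine dTV_le_of_theta_ge hn hP hπ hpos hβ hκ hε.1 (fun z => ?_) _
    (fun s hs hst => hκΘ s hs (hst.trans hceil_n)) (Nat.le_ceil X)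
  exact (hmin 0 (Nat.zero_le _)).trans (ciInf_le (Set.finite_range _).bddBelow z)
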